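/- Let κ > 0, b ≥ 0, let 0 < τ₁ ≤ τ₂, and let φ : [−τ₂, 0] → ℝ be Lipschitz with constant L. Let h₁ and h₂ be the solutions of the ENSO delay differential equation on [0, ∞) with delays τ₁ and τ₂ respectively, both with coupling κ, amplitude b, and initial history given by (the restriction of) φ. Then for every T > 0, sup_{t ∈ [0, T]} |h₁(t) − h₂(t)| ≤ κ · max(L, 1 + b) · |τ₁ − τ₂| · T · e^{κT}. In particular, the solution depends continuously on the delay τ on finite time intervals. -/

import Mathlib

open Real Set

/-- `h : ℝ → ℝ` is a solution of the ENSO delay differential equation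
`h'(t) = -tanh (κ * h (t - τ)) + b * cos (2 π t)` on `[0, ∞)` with delay `τ`,
coupling `κ`, forcing amplitude `b` and initial history `φ` on `[-τ, 0]`. -/
def IsSolution (τ κ b : ℝ) (φ h : ℝ → ℝ) : Prop :=
  ContinuousOn h (Set.Ici (-τ)) ∧
  (∀ t ∈ Set.Icc (-τ) (0 : ℝ), h t = φ t) ∧
  (∀ t > (0 : ℝ),
    HasDerivAt h (-Real.tanh (κ * h (t - τ)) + b * Real.cos (2 * π * t)) t) ∧
  HasDerivWithinAt h (-Real.tanh (κ * h ((0 : ℝ) - τ)) + b * Real.cos (2 * π * 0))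
    (Set.Ici 0) 0

theorem abs_tanh_sub_tanh_le (x y : ℝ) : |Real.tanh x - Real.tanh y| ≤ |x - y| := by
  have hderiv : ∀ z : ℝ, HasDerivAt Real.tanh (1 / Real.cosh z ^ 2) z := by
    intro z
    have h := (Real.hasDerivAt_sinh z).div (Real.hasDerivAt_cosh z) (Real.cosh_pos z).ne'
    have hfun : Real.tanh = Real.sinh / Real.cosh := by
      funext w
      exact Real.tanh_eq_sinh_div_cosh w
    rw [hfun]
    refine h.congr_deriv ?_
    congr 1
    linarith [Real.cosh_sq z, sq (Real.cosh z), sq (Real.sinh z)]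
  have h := convex_univ.norm_image_sub_le_of_norm_hasDerivWithin_le (f := Real.tanh) (C := 1)
    (fun z _ => (hderiv z).hasDerivWithinAt) (fun z _ => ?_) (mem_univ y) (mem_univ x)
  · simpa [Real.norm_eq_abs] using h
  · rw [Real.norm_of_nonneg (by positivity)]
    exact div_le_one_of_le₀ (one_le_pow₀ (Real.one_le_cosh z)) (by positivity)

namespace IsSolution

variable {τ κ b : ℝ} {φ h : ℝ → ℝ}

theorem hasDerivWithinAt (hsol : IsSolution τ κ b φ h) {t : ℝ} (ht : 0 ≤ t) :
    HasDerivWithinAt h (-Real.tanh (κ * h (t - τ)) + b * Real.cos (2 * π * t)) (Ici t) t := by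
  rcases ht.eq_or_lt with rfl | ht
  · exact hsol.2.2.2
  · exact (hsol.2.2.1 t ht).hasDerivWithinAt

theorem abs_sub_le_of_nonneg (hsol : IsSolution τ κ b φ h) (hτ : 0 ≤ τ) (hb : 0 ≤ b) {s t : ℝ}
    (hs : 0 ≤ s) (hst : s ≤ t) : |h t - h s| ≤ (1 + b) * (t - s) := by
  refine norm_image_sub_le_of_norm_deriv_right_le_segment (f := h) (a := s) (b := t)
    (hsol.1.mono fun x hx => ?_) (fun x hx => hsol.hasDerivWithinAt (hs.trans hx.1))
    (fun x _ => ?_) t (right_mem_Icc.2 hst)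
  · exact (by linarith [hx.1] : -τ ≤ x)
  · refine (norm_add_le _ _).trans (add_le_add ?_ ?_)
    · rw [norm_neg]
      exact (Real.abs_tanh_lt_one _).le
    · rw [norm_mul, Real.norm_of_nonneg hb]
      exact mul_le_of_le_one_right hb (Real.abs_cos_le_one _)

/-- A solution with an `L`-Lipschitz history is Lipschitz on its whole domain. -/
theorem abs_sub_le (hsol : IsSolution τ κ b φ h) (hτ : 0 ≤ τ) (hb : 0 ≤ b) {L : ℝ}
    (hφ : ∀ s₁ ∈ Icc (-τ) (0 : ℝ), ∀ s₂ ∈ Icc (-τ) (0 : ℝ), |φ s₁ - φ s₂| ≤ L * |s₁ - s₂|)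
    {s t : ℝ} (hs : -τ ≤ s) (hst : s ≤ t) : |h t - h s| ≤ max L (1 + b) * (t - s) := by
  have hist : ∀ u, s ≤ u → u ≤ 0 → |h u - h s| ≤ max L (1 + b) * (u - s) := by
    intro u hsu hu
    have hsm : s ∈ Icc (-τ) (0 : ℝ) := ⟨hs, hsu.trans hu⟩
    have hum : u ∈ Icc (-τ) (0 : ℝ) := ⟨hs.trans hsu, hu⟩
    rw [hsol.2.1 u hum, hsol.2.1 s hsm]
    refine (hφ u hum s hsm).trans ?_
    rw [abs_of_nonneg (sub_nonneg.2 hsu)]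
    exact mul_le_mul_of_nonneg_right (le_max_left _ _) (sub_nonneg.2 hsu)
  have fwd : ∀ u, 0 ≤ u → u ≤ t → |h t - h u| ≤ max L (1 + b) * (t - u) := fun u hu hut =>
    (hsol.abs_sub_le_of_nonneg hτ hb hu hut).trans
      (mul_le_mul_of_nonneg_right (le_max_right _ _) (sub_nonneg.2 hut))
  rcases le_total t 0 with ht | ht
  · exact hist t hst ht
  rcases le_total 0 s with hs0 | hs0
  · exact fwd s hs0 hst
  · have := _root_.abs_sub_le (h t) (h 0) (h s)
    linarith [hist 0 hs0 le_rfl, fwd 0 le_rfl ht]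

end IsSolution

/-- Continuous dependence of solutions of the ENSO DDE on the delay `τ`, on
finite time intervals, for a Lipschitz initial history. -/
theorem enso_dde_continuous_dependence_delay (τ₁ τ₂ κ b L : ℝ)
    (hτ₁ : 0 < τ₁) (hττ : τ₁ ≤ τ₂) (hκ : 0 < κ) (hb : 0 ≤ b) (hL : 0 ≤ L)
    (φ : ℝ → ℝ)
    (hφLip : ∀ s₁ ∈ Set.Icc (-τ₂) (0 : ℝ), ∀ s₂ ∈ Set.Icc (-τ₂) (0 : ℝ),
      |φ s₁ - φ s₂| ≤ L * |s₁ - s₂|)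
    (h₁ h₂ : ℝ → ℝ) (hsol₁ : IsSolution τ₁ κ b φ h₁) (hsol₂ : IsSolution τ₂ κ b φ h₂) :
    ∀ T > (0 : ℝ), ∀ t ∈ Set.Icc (0 : ℝ) T,
      |h₁ t - h₂ t| ≤ κ * max L (1 + b) * |τ₁ - τ₂| * T * Real.exp (κ * T) := by
  intro T _ t ht
  set K := κ * max L (1 + b) * |τ₁ - τ₂| with hK
  have hK0 : 0 ≤ K := by positivity
  have mono : ∀ s u : ℝ, 0 ≤ s → s ≤ u → K * s * Real.exp (κ * s) ≤ K * u * Real.exp (κ * u) := by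
    intro s u hs hsu
    have hu : 0 ≤ u := hs.trans hsu
    gcongr
  have hB : ∀ x : ℝ, HasDerivAt (fun x => K * x * Real.exp (κ * x))
      (K * Real.exp (κ * x) + K * x * (Real.exp (κ * x) * κ)) x := by
    intro x
    have hlin : ∀ c : ℝ, HasDerivAt (fun x => c * x) c x := fun c => by
      simpa using (hasDerivAt_id' x).const_mul c
    exact (hlin K).mul (hlin κ).exp
  have steps : ∀ n : ℕ, ∀ u ∈ Icc (0 : ℝ) (n * τ₁), |h₁ u - h₂ u| ≤ K * u * Real.exp (κ * u) := by
    have init : |h₁ 0 - h₂ 0| ≤ K * 0 * Real.exp (κ * 0) := by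
      rw [hsol₁.2.1 0 ⟨by linarith, le_rfl⟩, hsol₂.2.1 0 ⟨by linarith, le_rfl⟩]
      simp
    intro n
    induction n with
    | zero =>
      intro u hu
      obtain rfl : u = 0 := le_antisymm (by simpa using hu.2) hu.1
      exact init
    | succ n ih =>
      refine image_norm_le_of_norm_deriv_right_le_deriv_boundary (f := fun u => h₁ u - h₂ u)
        ((hsol₁.1.mono fun x hx => ?_).sub (hsol₂.1.mono fun x hx => ?_))
        (fun x hx => (hsol₁.hasDerivWithinAt hx.1).sub (hsol₂.hasDerivWithinAt hx.1))
        init hB (fun x hx => ?_)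
      · exact (by linarith [hx.1] : -τ₁ ≤ x)
      · exact (by linarith [hx.1] : -τ₂ ≤ x)
      · obtain ⟨hx0, hxn⟩ := hx
        have delayed : |h₁ (x - τ₁) - h₂ (x - τ₁)| ≤ K * x * Real.exp (κ * x) := by
          rcases le_total x τ₁ with hxτ | hxτ
          · rw [hsol₁.2.1 _ ⟨by linarith, by linarith⟩, hsol₂.2.1 _ ⟨by linarith, by linarith⟩,
              sub_self, abs_zero]
            positivity
          · push_cast at hxn
            exact (ih _ ⟨by linarith, by linarith⟩).trans
              (mono _ _ (by linarith) (by linarith))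
        have shift : κ * |h₂ (x - τ₁) - h₂ (x - τ₂)| ≤ K := by
          have := hsol₂.abs_sub_le (by linarith) hb hφLip (s := x - τ₂) (t := x - τ₁)
            (by linarith) (by linarith)
          rw [hK, abs_of_nonpos (by linarith : τ₁ - τ₂ ≤ 0), mul_assoc]
          refine mul_le_mul_of_nonneg_left (this.trans_eq ?_) hκ.le
          ring
        have hexp : K ≤ K * Real.exp (κ * x) :=
          le_mul_of_one_le_right hK0 (Real.one_le_exp (by positivity))
        calc _ = |Real.tanh (κ * h₁ (x - τ₁)) - Real.tanh (κ * h₂ (x - τ₂))| := by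
              rw [Real.norm_eq_abs, ← abs_neg]
              congr 1
              ring
          _ ≤ κ * |h₁ (x - τ₁) - h₂ (x - τ₂)| := by
              refine (abs_tanh_sub_tanh_le _ _).trans_eq ?_
              rw [← mul_sub, abs_mul, abs_of_pos hκ]
          _ ≤ κ * (|h₁ (x - τ₁) - h₂ (x - τ₁)| + |h₂ (x - τ₁) - h₂ (x - τ₂)|) :=
              mul_le_mul_of_nonneg_left (abs_sub_le _ _ _) hκ.le
          _ ≤ _ := by
              linarith [mul_le_mul_of_nonneg_left delayed hκ.le]
  obtain ⟨n, hn⟩ := exists_nat_ge (t / τ₁)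
  exact (steps n t ⟨ht.1, (div_le_iff₀ hτ₁).1 hn⟩).trans (mono t T ht.1 ht.2)
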